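/- arXiv:1206.1285 — 4 statements merged into one kernel-verified Lean document; each statement's English description precedes it below -/
import Mathlib

section
/- Let p, q, r be pairwise coprime positive integers, and let a, b, c be integers such that a·q ≡ p (mod r), b·p ≡ r (mod q), and c·r ≡ q (mod p). Then s(a, r) + s(b, q) + s(c, p) = -1/4 + (1/12)·(r/(p·q) + q/(p·r) + p/(q·r)), where s denotes the Dedekind sum. -/
open Real Finset

/-- The Dedekind sum `s(a, b) = (1/(4b)) · Σ_{j=1}^{b-1} cot(πj/b)·cot(πaj/b)`. -/
noncomputable def dedekindSum (a : ℤ) (b : ℕ) : ℝ :=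
  (1 / (4 * (b : ℝ))) * ∑ j ∈ Finset.Ico 1 b,
    Real.cot (Real.pi * j / b) * Real.cot (Real.pi * a * j / b)

lemma Real.cot_neg_eq_neg_cot (x : ℝ) : Real.cot (-x) = -Real.cot x := by
  simp [Real.cot_eq_cos_div_sin, div_neg]

lemma Real.cot_eq_zero_of_sin_eq_zero {x : ℝ} (h : Real.sin x = 0) : Real.cot x = 0 := by
  simp [Real.cot_eq_cos_div_sin, h]

lemma Real.cot_add_int_mul_pi (x : ℝ) (m : ℤ) : Real.cot (x + m * π) = Real.cot x := by
  rw [Real.cot_eq_cos_div_sin, Real.cot_eq_cos_div_sin, Real.cos_add_int_mul_pi,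
    Real.sin_add_int_mul_pi, mul_div_mul_left]
  exact zpow_ne_zero _ (by norm_num)

/-- The products of pairs of cotangents of three angles with sum zero add up to `1`,
unless two of the angles `α`, `β`, `γ` coincide. -/
lemma cot_sub_mul_cot_sub_cyclic {α β γ : ℝ} (hαβ : sin (α - β) = 0 → α = β)
    (hβγ : sin (β - γ) = 0 → β = γ) (hγα : sin (γ - α) = 0 → γ = α) :
    Real.cot (α - β) * Real.cot (α - γ) + Real.cot (β - γ) * Real.cot (β - α)
      + Real.cot (γ - α) * Real.cot (γ - β) =
    -1 + (if α = β then 1 + Real.cot (γ - α) ^ 2 else 0)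
      + (if β = γ then 1 + Real.cot (α - β) ^ 2 else 0)
      + (if γ = α then 1 + Real.cot (β - γ) ^ 2 else 0)
      - (if α = β ∧ β = γ then 2 else 0) := by
  have hz : Real.cot 0 = 0 := cot_eq_zero_of_sin_eq_zero sin_zero
  have h₁ : Real.cot (β - α) = -Real.cot (α - β) := by rw [← cot_neg_eq_neg_cot, neg_sub]
  have h₂ : Real.cot (γ - β) = -Real.cot (β - γ) := by rw [← cot_neg_eq_neg_cot, neg_sub]
  have h₃ : Real.cot (α - γ) = -Real.cot (γ - α) := by rw [← cot_neg_eq_neg_cot, neg_sub]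
  rcases eq_or_ne α β with rfl | h₁₂
  · rcases eq_or_ne α γ with rfl | h₁₃
    · norm_num [hz]
    · simp only [sub_self, hz, h₁₃, h₁₃.symm, h₂, if_true, if_false, and_false]
      ring
  rcases eq_or_ne β γ with rfl | h₂₃
  · simp only [sub_self, hz, h₁, h₁₂, h₁₂.symm, if_true, if_false, false_and]
    ring
  rcases eq_or_ne γ α with rfl | h₃₁
  · simp only [sub_self, hz, h₂, h₁₂, h₂₃, if_true, if_false, false_and]
    ring
  simp only [h₁₂, h₂₃, h₃₁, if_false, false_and, h₁, h₂, h₃]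
  have s₁ : sin (α - β) ≠ 0 := mt hαβ h₁₂
  have s₂ : sin (β - γ) ≠ 0 := mt hβγ h₂₃
  have s₃ : sin (γ - α) ≠ 0 := mt hγα h₃₁
  have e : γ - α = -((α - β) + (β - γ)) := by ring
  rw [e, sin_neg, sin_add, neg_ne_zero] at s₃
  rw [e, cot_neg_eq_neg_cot]
  simp only [Real.cot_eq_cos_div_sin, sin_add, cos_add]
  field_simp
  ring

/-- The function `z ↦ cot (π z / n)` on `ZMod n`. -/
noncomputable def cotMod (n : ℕ) (z : ZMod n) : ℝ := Real.cot (π * z.val / n)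

section cotMod

variable {n : ℕ} [NeZero n]

lemma cotMod_intCast (m : ℤ) : cotMod n (m : ZMod n) = Real.cot (π * m / n) := by
  have hn : (n : ℝ) ≠ 0 := NeZero.ne _
  have h : (((m : ZMod n).val : ℤ) : ℝ) = (m : ℝ) - n * ((m / n : ℤ) : ℝ) := by
    rw [ZMod.val_intCast, Int.emod_def]
    push_cast
    ring
  rw [Int.cast_natCast] at h
  rw [cotMod, h, ← Real.cot_add_int_mul_pi _ (m / n)]
  congr 1
  field_simp
  ring

lemma cotMod_zero : cotMod n 0 = 0 := by
  simpa [Real.cot_eq_cos_div_sin] using cotMod_intCast (n := n) 0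

lemma cotMod_sub (x y : ZMod n) :
    cotMod n (x - y) = Real.cot (π * x.val / n - π * y.val / n) := by
  have h : x - y = (((x.val : ℤ) - (y.val : ℤ) : ℤ) : ZMod n) := by simp
  rw [h, cotMod_intCast]
  push_cast
  congr 1
  ring

lemma cotMod_neg (x : ZMod n) : cotMod n (-x) = -cotMod n x := by
  rw [← zero_sub, cotMod_sub, cotMod, ← Real.cot_neg_eq_neg_cot]
  simp

lemma cotMod_intCast_mul (m : ℤ) (x : ZMod n) :
    cotMod n (m * x) = Real.cot (π * m * x.val / n) := by
  have h : m * x = ((m * (x.val : ℤ) : ℤ) : ZMod n) := by simp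
  rw [h, cotMod_intCast]
  push_cast
  ring_nf

lemma sum_cotMod : ∑ z, cotMod n z = 0 := by
  have h : ∑ z, cotMod n (-z) = ∑ z, cotMod n z := Equiv.sum_comp (Equiv.neg _) (cotMod n)
  simp only [cotMod_neg, sum_neg_distrib] at h
  linarith

lemma sum_cotMod_sub (x : ZMod n) : ∑ y, cotMod n (x - y) = 0 :=
  (Equiv.sum_comp (Equiv.subLeft x) (cotMod n)).trans sum_cotMod

lemma eq_zero_of_sin_sub_eq_zero {r p : ℕ} [NeZero r] [NeZero p] (hrp : r.Coprime p) {x : ZMod r}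
    {y : ZMod p} (h : sin (π * x.val / r - π * y.val / p) = 0) : x = 0 ∧ y = 0 := by
  obtain ⟨m, hm⟩ := sin_eq_zero_iff.mp h
  have hr : (r : ℝ) ≠ 0 := NeZero.ne _
  have hp : (p : ℝ) ≠ 0 := NeZero.ne _
  have hm' : (m : ℝ) * r * p = x.val * p - y.val * r := by
    field_simp at hm
    linarith
  have hm'' : m * r * p = x.val * p - y.val * r := by exact_mod_cast hm'
  have hc : IsCoprime (r : ℤ) p := Nat.isCoprime_iff_coprime.mpr hrp
  constructor
  · have hd : (r : ℤ) ∣ x.val := hc.dvd_of_dvd_mul_right ⟨m * p + y.val, by linear_combination -hm''⟩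
    rw [← ZMod.natCast_zmod_val x]
    exact (ZMod.natCast_eq_zero_iff _ _).mpr (Int.natCast_dvd_natCast.mp hd)
  · have hd : (p : ℤ) ∣ y.val :=
      hc.symm.dvd_of_dvd_mul_right ⟨x.val - m * r, by linear_combination hm''⟩
    rw [← ZMod.natCast_zmod_val y]
    exact (ZMod.natCast_eq_zero_iff _ _).mpr (Int.natCast_dvd_natCast.mp hd)

lemma eq_of_sin_sub_same_eq_zero {x y : ZMod n} (h : sin (π * x.val / n - π * y.val / n) = 0) :
    x = y := by
  obtain ⟨m, hm⟩ := sin_eq_zero_iff.mp h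
  have hn : (n : ℝ) ≠ 0 := NeZero.ne _
  have hm' : (m : ℝ) * n = x.val - y.val := by
    field_simp at hm
    linarith
  have hm'' : m * n = x.val - y.val := by exact_mod_cast hm'
  have := congrArg (Int.cast : ℤ → ZMod n) hm''
  simp only [Int.cast_mul, Int.cast_natCast, CharP.cast_eq_zero, mul_zero, Int.cast_sub,
    ZMod.natCast_zmod_val] at this
  exact sub_eq_zero.mp this.symm

lemma angle_inj {x y : ZMod n} : π * x.val / n = π * y.val / n ↔ x = y :=
  ⟨fun h ↦ eq_of_sin_sub_same_eq_zero (by rw [h, sub_self, sin_zero]), fun h ↦ by rw [h]⟩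

lemma sum_cotMod_sq : ∑ z, cotMod n z ^ 2 = ((n : ℝ) - 1) * (n - 2) / 3 := by
  have key (x y z : ZMod n) :
      cotMod n (x - y) * cotMod n (x - z) + cotMod n (y - z) * cotMod n (y - x)
        + cotMod n (z - x) * cotMod n (z - y) =
      -1 + (if x = y then 1 + cotMod n (z - x) ^ 2 else 0)
        + (if y = z then 1 + cotMod n (x - y) ^ 2 else 0)
        + (if z = x then 1 + cotMod n (y - z) ^ 2 else 0)
        - (if x = y then if y = z then 2 else 0 else 0) := by
    have h := cot_sub_mul_cot_sub_cyclic (α := π * x.val / n) (β := π * y.val / n)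
      (γ := π * z.val / n) (fun h ↦ angle_inj.2 (eq_of_sin_sub_same_eq_zero h))
      (fun h ↦ angle_inj.2 (eq_of_sin_sub_same_eq_zero h))
      (fun h ↦ angle_inj.2 (eq_of_sin_sub_same_eq_zero h))
    simpa only [cotMod_sub, angle_inj, ite_and] using h
  have hn : (n : ℝ) ≠ 0 := NeZero.ne _
  have h₁ (x : ZMod n) : ∑ y, ∑ z, cotMod n (x - y) * cotMod n (x - z) = 0 := by
    simp [← mul_sum, sum_cotMod_sub]
  have h₂ : ∑ x, ∑ y, ∑ z, cotMod n (y - z) * cotMod n (y - x) = 0 := by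
    simp [← sum_mul, sum_cotMod_sub]
  have h₃ : ∑ x, ∑ y, ∑ z, cotMod n (z - x) * cotMod n (z - y) = 0 := by
    refine sum_eq_zero fun x _ ↦ ?_
    rw [sum_comm]
    simp [← mul_sum, sum_cotMod_sub]
  have h₄ (x : ZMod n) : ∑ z, cotMod n (z - x) ^ 2 = ∑ z, cotMod n z ^ 2 :=
    Equiv.sum_comp (Equiv.subRight x) (cotMod n · ^ 2)
  have h₅ (x : ZMod n) : ∑ z, cotMod n (x - z) ^ 2 = ∑ z, cotMod n z ^ 2 :=
    Equiv.sum_comp (Equiv.subLeft x) (cotMod n · ^ 2)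
  have hsum := sum_congr rfl fun x (_ : x ∈ univ) ↦ sum_congr rfl fun y (_ : y ∈ univ) ↦
    sum_congr rfl fun z (_ : z ∈ univ) ↦ key x y z
  have h₆ (x y : ZMod n) : ∑ z, (if x = y then 1 + cotMod n (z - x) ^ 2 else 0) =
      if x = y then ∑ z, (1 + cotMod n (z - x) ^ 2) else 0 := by split_ifs <;> simp
  have h₇ (x y : ZMod n) : ∑ z, (if x = y then if y = z then (2 : ℝ) else 0 else 0) =
      if x = y then 2 else 0 := by split_ifs <;> simp
  simp only [sum_add_distrib, sum_sub_distrib, h₁, h₂, h₃, h₆, h₇, sum_ite_eq, sum_ite_eq', h₄, h₅,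
    mem_univ, if_true, sum_const, card_univ, ZMod.card, nsmul_eq_mul] at hsum
  refine mul_left_cancel₀ hn ?_
  linear_combination -hsum / 3

end cotMod

lemma IsPrimitiveRoot.sum_add_one_div_one_sub {K : Type*} [Field K] {n : ℕ} {ζ w : K}
    (hζ : IsPrimitiveRoot ζ n) (hw : w ^ n ≠ 1) :
    ∑ k ∈ range n, (w * ζ ^ k + 1) / (1 - w * ζ ^ k) = n * ((w ^ n + 1) / (1 - w ^ n)) := by
  have hw' : 1 - w ^ n ≠ 0 := sub_ne_zero.2 hw.symm
  have hn : n ≠ 0 := by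
    rintro rfl
    exact hw (pow_zero w)
  have hpow (k : ℕ) : (w * ζ ^ k) ^ n = w ^ n := by
    rw [mul_pow, ← pow_mul, mul_comm k, pow_mul, hζ.pow_eq_one, one_pow, mul_one]
  have hterm (k : ℕ) : (w * ζ ^ k + 1) / (1 - w * ζ ^ k) =
      2 * (∑ m ∈ range n, (w * ζ ^ k) ^ m) / (1 - w ^ n) - 1 := by
    have h1 : 1 - w * ζ ^ k ≠ 0 := fun h ↦ hw <| by
      rw [← hpow k, ← sub_eq_zero.1 h, one_pow]
    have h2 := mul_neg_geom_sum (w * ζ ^ k) n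
    rw [hpow] at h2
    rw [← h2] at hw' ⊢
    have h3 := right_ne_zero_of_mul hw'
    field_simp
    ring
  have horth : ∑ k ∈ range n, ∑ m ∈ range n, (w * ζ ^ k) ^ m = n := by
    rw [sum_comm, sum_eq_single_of_mem 0 (mem_range.2 (Nat.pos_of_ne_zero hn))]
    · simp
    · intro m hm hm0
      have h1 : ζ ^ m ≠ 1 := hζ.pow_ne_one_of_pos_of_lt hm0 (mem_range.1 hm)
      have h2 := geom_sum_mul (ζ ^ m) n
      rw [← pow_mul, mul_comm m, pow_mul, hζ.pow_eq_one, one_pow, sub_self] at h2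
      have h3 := (mul_eq_zero.1 h2).resolve_right (sub_ne_zero.2 h1)
      simp only [mul_pow, ← mul_sum]
      simp only [← pow_mul] at h3
      simp only [← pow_mul, mul_comm _ m, h3, mul_zero]
  simp only [hterm, sum_sub_distrib, ← sum_div, ← mul_sum, horth, sum_const, card_range,
    nsmul_eq_mul]
  field_simp
  ring

/-- The distribution relation of the cotangent. -/
lemma sum_cot_sub {n : ℕ} [NeZero n] {x : ℝ} (hx : sin (n * x) ≠ 0) :
    ∑ y : ZMod n, Real.cot (x - π * y.val / n) = n * Real.cot (n * x) := by
  have hn : (n : ℂ) ≠ 0 := NeZero.ne _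
  have hζ := (Complex.isPrimitiveRoot_exp n (NeZero.ne n)).inv
  set ζ := (Complex.exp (2 * π * Complex.I / n))⁻¹ with hζ_def
  set w := Complex.exp (2 * Complex.I * x) with hw_def
  have hwn : w ^ n = Complex.exp (2 * Complex.I * (n * x)) := by
    rw [hw_def, ← Complex.exp_nat_mul]
    ring_nf
  have hw : w ^ n ≠ 1 := by
    intro h
    rw [hwn, Complex.exp_eq_one_iff] at h
    obtain ⟨m, hm⟩ := h
    refine hx (sin_eq_zero_iff.2 ⟨m, ?_⟩)
    have h2 : (2 * Complex.I) * ((m * π : ℝ) : ℂ) = (2 * Complex.I) * ((n * x : ℝ) : ℂ) := by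
      push_cast
      linear_combination -hm
    exact_mod_cast mul_left_cancel₀ (by simp) h2
  have h₁ : ∑ y : ZMod n, Real.cot (x - π * y.val / n) =
      ∑ k ∈ range n, Real.cot (x - π * k / n) :=
    sum_bij (fun y _ ↦ y.val) (fun y _ ↦ mem_range.2 y.val_lt)
      (fun y _ z _ h ↦ ZMod.val_injective n h)
      (fun k hk ↦ ⟨k, mem_univ _, ZMod.val_cast_of_lt (mem_range.1 hk)⟩) fun _ _ ↦ rfl
  have h₂ (k : ℕ) : w * ζ ^ k = Complex.exp (2 * Complex.I * (x - π * k / n)) := by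
    rw [hw_def, hζ_def, ← Complex.exp_neg, ← Complex.exp_nat_mul, ← Complex.exp_add]
    congr 1
    field_simp
    ring
  rw [h₁]
  apply Complex.ofReal_injective
  have h := hζ.sum_add_one_div_one_sub hw
  simp only [h₂, hwn] at h
  push_cast
  simp only [Complex.cot_eq_exp_ratio, mul_comm Complex.I (1 - _), ← div_div, ← sum_div, h]
  rw [mul_div_assoc]

lemma sum_cot_sub_of_coprime {r p : ℕ} [NeZero r] [NeZero p] (hrp : r.Coprime p) (x : ZMod r) :
    ∑ y : ZMod p, Real.cot (π * x.val / r - π * y.val / p) = p * cotMod r (p * x) := by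
  have hp : (p : ℝ) ≠ 0 := NeZero.ne _
  have hx := cotMod_intCast_mul (p : ℤ) x
  rw [Int.cast_natCast, Int.cast_natCast,
    show π * p * x.val / r = p * (π * x.val / r) by ring] at hx
  rcases eq_or_ne x 0 with rfl | h0
  · have h := sum_cotMod_sub (0 : ZMod p)
    simp only [cotMod_sub] at h
    simpa [cotMod_zero] using h
  · rw [hx]
    refine sum_cot_sub fun h ↦ h0 ?_
    obtain ⟨m, hm⟩ := sin_eq_zero_iff.mp h
    have hr : (r : ℝ) ≠ 0 := NeZero.ne _
    have hm' : (m : ℝ) * r = p * x.val := by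
      field_simp at hm
      linarith
    have hm'' : m * r = p * x.val := by exact_mod_cast hm'
    have hc : IsCoprime (r : ℤ) p := Nat.isCoprime_iff_coprime.mpr hrp
    have hd : (r : ℤ) ∣ x.val := hc.dvd_of_dvd_mul_left ⟨m, by linear_combination -hm''⟩
    rw [← ZMod.natCast_zmod_val x]
    exact (ZMod.natCast_eq_zero_iff _ _).mpr (Int.natCast_dvd_natCast.mp hd)

lemma dedekindSum_eq_sum_cotMod {n p q : ℕ} [NeZero n] (hq : q.Coprime n) {a : ℤ}
    (ha : a * q ≡ p [ZMOD n]) :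
    dedekindSum a n = 1 / (4 * n) * ∑ x : ZMod n, cotMod n (p * x) * cotMod n (q * x) := by
  have ha' : (a : ZMod n) * q = p := by
    exact_mod_cast (ZMod.intCast_eq_intCast_iff _ _ _).mpr ha
  have h₁ : ∑ x : ZMod n, cotMod n (p * x) * cotMod n (q * x) =
      ∑ x : ZMod n, cotMod n x * cotMod n (a * x) := by
    rw [← Equiv.sum_comp (ZMod.unitOfCoprime q hq).mulLeft fun x ↦ cotMod n x * cotMod n (a * x)]
    refine sum_congr rfl fun x _ ↦ ?_
    simp only [← ha', Units.mulLeft_apply, ZMod.coe_unitOfCoprime]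
    rw [mul_assoc, mul_comm]
  have h₂ : ∑ x : ZMod n, cotMod n x * cotMod n (a * x) =
      ∑ j ∈ range n, Real.cot (π * j / n) * Real.cot (π * a * j / n) := by
    refine sum_bij (fun x _ ↦ x.val) (fun x _ ↦ mem_range.2 x.val_lt)
      (fun x _ y _ h ↦ ZMod.val_injective n h)
      (fun j hj ↦ ⟨j, mem_univ _, ZMod.val_cast_of_lt (mem_range.1 hj)⟩) fun x _ ↦ ?_
    rw [cotMod_intCast_mul, cotMod]
  rw [dedekindSum, h₁, h₂, range_eq_Ico, sum_eq_sum_Ico_succ_bot (NeZero.pos n)]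
  simp [Real.cot_eq_cos_div_sin]

/-- Rademacher's triple reciprocity law for Dedekind sums. -/
theorem rademacher_triple_reciprocity
    (p q r : ℕ) (hp : 0 < p) (hq : 0 < q) (hr : 0 < r)
    (hpq : Nat.Coprime p q) (hqr : Nat.Coprime q r) (hpr : Nat.Coprime p r)
    (a b c : ℤ)
    (ha : a * (q : ℤ) ≡ (p : ℤ) [ZMOD (r : ℤ)])
    (hb : b * (p : ℤ) ≡ (r : ℤ) [ZMOD (q : ℤ)])
    (hc : c * (r : ℤ) ≡ (q : ℤ) [ZMOD (p : ℤ)]) :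
    dedekindSum a r + dedekindSum b q + dedekindSum c p =
      -1/4 + (1/12) * ((r : ℝ) / (p * q) + (q : ℝ) / (p * r) + (p : ℝ) / (q * r)) := by
  have : NeZero p := ⟨hp.ne'⟩
  have : NeZero q := ⟨hq.ne'⟩
  have : NeZero r := ⟨hr.ne'⟩
  rw [dedekindSum_eq_sum_cotMod hqr ha, dedekindSum_eq_sum_cotMod hpq hb,
    dedekindSum_eq_sum_cotMod hpr.symm hc]
  let α (n : ℕ) (x : ZMod n) : ℝ := π * x.val / n
  have hα {m n : ℕ} [NeZero m] [NeZero n] (h : m.Coprime n) (x : ZMod m) (y : ZMod n) :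
      α m x = α n y ↔ x = 0 ∧ y = 0 :=
    ⟨fun e ↦ eq_zero_of_sin_sub_eq_zero h <|
        show sin (α m x - α n y) = 0 by rw [e, sub_self, sin_zero],
      by rintro ⟨rfl, rfl⟩; simp [α]⟩
  have hα' {m n : ℕ} [NeZero m] [NeZero n] (h : m.Coprime n) {x : ZMod m} {y : ZMod n}
      (e : sin (α m x - α n y) = 0) : α m x = α n y :=
    (hα h x y).2 (eq_zero_of_sin_sub_eq_zero h e)
  have hdist {m n : ℕ} [NeZero m] [NeZero n] (h : m.Coprime n) (x : ZMod m) :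
      ∑ y, Real.cot (α m x - α n y) = n * cotMod m (n * x) := sum_cot_sub_of_coprime h x
  have key (x : ZMod p) (y : ZMod q) (z : ZMod r) :
      Real.cot (α p x - α q y) * Real.cot (α p x - α r z)
        + Real.cot (α q y - α r z) * Real.cot (α q y - α p x)
        + Real.cot (α r z - α p x) * Real.cot (α r z - α q y) =
      -1 + (if x = 0 then if y = 0 then 1 + cotMod r z ^ 2 else 0 else 0)
        + (if y = 0 then if z = 0 then 1 + cotMod p x ^ 2 else 0 else 0)
        + (if z = 0 then if x = 0 then 1 + cotMod q y ^ 2 else 0 else 0)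
        - (if x = 0 then if y = 0 then if z = 0 then 2 else 0 else 0 else 0) := by
    rw [cot_sub_mul_cot_sub_cyclic (hα' hpq) (hα' hqr) (hα' hpr.symm)]
    simp only [hα hpq, hα hqr, hα hpr.symm]
    by_cases hx : x = 0 <;> by_cases hy : y = 0 <;> by_cases hz : z = 0 <;>
      simp [hx, hy, hz, α, cotMod]
  have hsum := sum_congr rfl fun x (_ : x ∈ univ) ↦ sum_congr rfl fun y (_ : y ∈ univ) ↦
    sum_congr rfl fun z (_ : z ∈ univ) ↦ key x y z
  have h₁ : ∑ x, ∑ y, ∑ z, Real.cot (α p x - α q y) * Real.cot (α p x - α r z) =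
      q * r * ∑ x, cotMod p (q * x) * cotMod p (r * x) := by
    simp only [← mul_sum, ← sum_mul, hdist hpq, hdist hpr]
    rw [mul_sum]
    exact sum_congr rfl fun _ _ ↦ by ring
  have h₂ : ∑ x, ∑ y, ∑ z, Real.cot (α q y - α r z) * Real.cot (α q y - α p x) =
      r * p * ∑ y, cotMod q (r * y) * cotMod q (p * y) := by
    rw [sum_comm]
    simp only [← mul_sum, ← sum_mul, hdist hqr, hdist hpq.symm]
    rw [mul_sum]
    exact sum_congr rfl fun _ _ ↦ by ring
  have h₃ : ∑ x, ∑ y, ∑ z, Real.cot (α r z - α p x) * Real.cot (α r z - α q y) =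
      p * q * ∑ z, cotMod r (p * z) * cotMod r (q * z) := by
    simp only [sum_comm (t := (univ : Finset (ZMod r)))]
    simp only [← mul_sum, ← sum_mul, hdist hpr.symm, hdist hqr.symm]
    rw [mul_sum]
    exact sum_congr rfl fun _ _ ↦ by ring
  have hite {ι : Type} [Fintype ι] (P : Prop) [Decidable P] (f : ι → ℝ) :
      ∑ i, (if P then f i else 0) = if P then ∑ i, f i else 0 := by split_ifs <;> simp
  simp only [sum_add_distrib, sum_sub_distrib, h₁, h₂, h₃, hite, sum_ite_eq', mem_univ, if_true,
    sum_cotMod_sq, sum_const, card_univ, ZMod.card, nsmul_eq_mul] at hsum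
  have hp' : (p : ℝ) ≠ 0 := NeZero.ne _
  have hq' : (q : ℝ) ≠ 0 := NeZero.ne _
  have hr' : (r : ℝ) ≠ 0 := NeZero.ne _
  field_simp
  linear_combination 12 * hsum
end

section
/- For real numbers r, q, p with 1 ≤ r ≤ q ≤ p, the inequality r/(p·q) + q/(p·r) + p/(q·r) ≤ 2/r + 2/q + 2/p holds if and only if p ≤ (√q + √r)². -/
/-- For `1 ≤ r ≤ q ≤ p`, the Hitchin–Thorpe inequality
  `r/(pq) + q/(pr) + p/(qr) ≤ 2/r + 2/q + 2/p` holds iff `p ≤ (√q + √r)²`. -/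
theorem hitchin_thorpe_ineq_iff (r q p : ℝ) (h1 : 1 ≤ r) (hrq : r ≤ q) (hqp : q ≤ p) :
    r / (p * q) + q / (p * r) + p / (q * r) ≤ 2 / r + 2 / q + 2 / p ↔
      p ≤ (Real.sqrt q + Real.sqrt r) ^ 2 := by
  have hr : 0 < r := by linarith
  have hq : 0 < q := by linarith
  have hp : 0 < p := by linarith
  have hb : 0 < √r := Real.sqrt_pos.2 hr
  have hba : √r ≤ √q := Real.sqrt_le_sqrt hrq
  have hqa : √q ^ 2 = q := Real.sq_sqrt hq.le
  have hrb : √r ^ 2 = r := Real.sq_sqrt hr.le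
  have hpos : 0 < p - (√q - √r) ^ 2 := by nlinarith
  have key : 2 / r + 2 / q + 2 / p - (r / (p * q) + q / (p * r) + p / (q * r)) =
      (p - (√q - √r) ^ 2) / (p * q * r) * ((√q + √r) ^ 2 - p) := by
    have hprod : (p - (√q - √r) ^ 2) * ((√q + √r) ^ 2 - p) =
        2 * (p * q + p * r + q * r) - (r ^ 2 + q ^ 2 + p ^ 2) := by
      rw [← hqa, ← hrb, Real.sqrt_sq (Real.sqrt_nonneg q), Real.sqrt_sq (Real.sqrt_nonneg r)]
      ring
    rw [div_mul_eq_mul_div, hprod]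
    field_simp
  rw [← sub_nonneg, key, mul_nonneg_iff_of_pos_left (by positivity), sub_nonneg]
end

section
/- For pairwise coprime positive integers r, q, p with r ≤ q ≤ p, the equality 4π√6·√(2/r + 2/q + 2/p − r/(p·q) − q/(p·r) − p/(q·r)) = 4π√2·(r+q+p)/√(r·q·p) holds if and only if r = q = p = 1. -/
/-- The two estimates agree at positive real weights exactly when the weights are equal. -/
theorem yamabe_estimates_eq_iff {a b c : ℝ} (ha : 0 < a) (hb : 0 < b) (hc : 0 < c) :
    4 * Real.pi * Real.sqrt 6 *
        Real.sqrt (2 / a + 2 / b + 2 / c - a / (c * b) - b / (c * a) - c / (b * a))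
      = 4 * Real.pi * Real.sqrt 2 * (a + b + c) / Real.sqrt (a * b * c) ↔
      a = b ∧ b = c := by
  set E := 2 / a + 2 / b + 2 / c - a / (c * b) - b / (c * a) - c / (b * a) with hE
  have habc : 0 < a * b * c := by positivity
  have hF : 0 < 2 * (a + b + c) ^ 2 / (a * b * c) := by positivity
  have hl : 4 * Real.pi * √6 * √E = 4 * Real.pi * √(6 * E) := by
    rw [Real.sqrt_mul (by norm_num), mul_assoc]
  have hu : 4 * Real.pi * √2 * (a + b + c) / √(a * b * c)
      = 4 * Real.pi * √(2 * (a + b + c) ^ 2 / (a * b * c)) := by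
    rw [Real.sqrt_div (by positivity), Real.sqrt_mul (zero_le_two (α := ℝ)),
      Real.sqrt_sq (by positivity)]
    ring
  have hdiff : 2 * (a + b + c) ^ 2 / (a * b * c) - 6 * E
      = 4 * ((a - b) ^ 2 + (b - c) ^ 2 + (a - c) ^ 2) / (a * b * c) := by
    rw [hE]
    field_simp
    ring
  rw [hl, hu, mul_right_inj' (by positivity)]
  constructor
  · intro h
    have h6E : 0 < 6 * E := Real.sqrt_pos.mp (h ▸ Real.sqrt_pos.mpr hF)
    rw [Real.sqrt_inj h6E.le hF.le] at h
    rw [h, sub_self, eq_comm, div_eq_zero_iff, or_iff_left habc.ne'] at hdiff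
    have hab : (a - b) ^ 2 = 0 := by
      nlinarith [sq_nonneg (a - b), sq_nonneg (b - c), sq_nonneg (a - c)]
    have hbc : (b - c) ^ 2 = 0 := by
      nlinarith [sq_nonneg (a - b), sq_nonneg (b - c), sq_nonneg (a - c)]
    exact ⟨sub_eq_zero.mp (pow_eq_zero_iff two_ne_zero |>.mp hab),
      sub_eq_zero.mp (pow_eq_zero_iff two_ne_zero |>.mp hbc)⟩
  · rintro ⟨hab, hbc⟩
    have hac : a = c := hab.trans hbc
    congr 1
    rw [sub_eq_zero.mpr hab, sub_eq_zero.mpr hbc, sub_eq_zero.mpr hac] at hdiff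
    norm_num at hdiff
    linarith

/-- For pairwise coprime positive integers `r ≤ q ≤ p`, the lower estimate
  `4π√6·√(2/r + 2/q + 2/p − r/(pq) − q/(pr) − p/(qr))` equals the upper estimate
  `4π√2·(r+q+p)/√(rqp)` for the orbifold Yamabe invariant iff `r = q = p = 1`. -/
theorem yamabe_bounds_coincide_iff (r q p : ℕ) (hr : 0 < r) (hq : 0 < q) (hp : 0 < p)
    (hrq : r ≤ q) (hqp : q ≤ p)
    (crq : Nat.Coprime r q) (cqp : Nat.Coprime q p) (crp : Nat.Coprime r p) :
    4 * Real.pi * Real.sqrt 6 *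
        Real.sqrt (2 / (r : ℝ) + 2 / (q : ℝ) + 2 / (p : ℝ)
          - (r : ℝ) / (p * q) - (q : ℝ) / (p * r) - (p : ℝ) / (q * r))
      = 4 * Real.pi * Real.sqrt 2 * ((r : ℝ) + q + p) / Real.sqrt ((r : ℝ) * q * p) ↔
      r = 1 ∧ q = 1 ∧ p = 1 := by
  rw [yamabe_estimates_eq_iff (Nat.cast_pos.mpr hr) (Nat.cast_pos.mpr hq)
    (Nat.cast_pos.mpr hp), Nat.cast_inj, Nat.cast_inj]
  constructor
  · rintro ⟨rfl, rfl⟩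
    have h := (Nat.coprime_self r).mp crq
    exact ⟨h, h, h⟩
  · rintro ⟨rfl, rfl, rfl⟩
    exact ⟨rfl, rfl⟩
end

section
/- Let x, y be real numbers with 0 < x ≤ y ≤ 1. If y > (1 + 2/√3)·(1 − x), then (x + y + 1)² < 12·x·y. -/
/-- For `0 < x ≤ y ≤ 1` with `y > (1 + 2/√3)(1 − x)`, one has `(x + y + 1)² < 12xy`. -/
theorem above_chord_implies_ineq (x y : ℝ) (hx : 0 < x) (hxy : x ≤ y) (hy1 : y ≤ 1)
    (h : y > (1 + 2 / Real.sqrt 3) * (1 - x)) :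
    (x + y + 1) ^ 2 < 12 * x * y := by
  have hs : Real.sqrt 3 ^ 2 = 3 := Real.sq_sqrt (by norm_num)
  have hs0 : 0 < Real.sqrt 3 := by positivity
  have hdiv : 2 / Real.sqrt 3 = 2 * Real.sqrt 3 / 3 := by
    field_simp
    linarith
  rw [hdiv] at h
  set s := Real.sqrt 3
  obtain ⟨L, hL⟩ : ∃ L, L = y - (1 + 2 * s / 3) * (1 - x) := ⟨_, rfl⟩
  have hL0 : 0 < L := by linarith
  -- Barycentric expansion in the triangle cut off by the chord.
  have key : 12 * x * y - (x + y + 1) ^ 2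
      = 4 * ((y - x) * (1 - y)) + 4 * (s * L * (1 - x)) + 3 * L ^ 2 := by
    rw [hL]
    linear_combination (4 / 3) * (1 - x) ^ 2 * hs
  have h₁ : 0 ≤ (y - x) * (1 - y) := mul_nonneg (by linarith) (by linarith)
  have h₂ : 0 ≤ s * L * (1 - x) := mul_nonneg (by positivity) (by linarith)
  have h₃ : 0 < L ^ 2 := by positivity
  linarith
end
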